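/- arXiv:1903.03703 — 6 statements merged into one kernel-verified Lean document; each statement's English description precedes it below -/
import Mathlib

section
/- Let u : ℝ → ℝ be a C^∞ function with compact support such that u(0) = 0, and let w : ℝ → ℝ be the C^∞ function with w(x) = u(x)/x for x ≠ 0 and w(0) = u'(0). Then for every integer s ≥ 0, (∫₀^∞ |w^{(s)}(x)|² dx)^{1/2} ≤ (1/(s + 1/2)) · (∫₀^∞ |u^{(s+1)}(x)|² dx)^{1/2}. -/
theorem iteratedDeriv_succ_id_mul {w : ℝ → ℝ} (hw : ContDiff ℝ (⊤ : ℕ∞) w) (s : ℕ) :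
    iteratedDeriv (s + 1) (fun x => x * w x) =
      fun x => x * iteratedDeriv (s + 1) w x + ((s : ℝ) + 1) * iteratedDeriv s w x := by
  have hd : ∀ (n : ℕ) (x : ℝ),
      HasDerivAt (iteratedDeriv n w) (iteratedDeriv (n + 1) w x) x := fun n x => by
    rw [iteratedDeriv_succ]
    exact ((hw.differentiable_iteratedDeriv n (by exact_mod_cast WithTop.coe_lt_top n)) x).hasDerivAt
  induction s with
  | zero =>
    ext x
    have h := (hasDerivAt_id' x).mul (hd 0 x)
    simp only [iteratedDeriv_zero, zero_add] at h
    rw [iteratedDeriv_succ, iteratedDeriv_zero]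
    refine h.deriv.trans ?_
    simp only [iteratedDeriv_zero, zero_add, Nat.cast_zero]
    ring
  | succ n ih =>
    ext x
    rw [iteratedDeriv_succ, ih]
    have h := ((hasDerivAt_id' x).mul (hd (n + 1) x)).add ((hd n x).const_mul ((n : ℝ) + 1))
    refine h.deriv.trans ?_
    push_cast
    ring

theorem HasCompactSupport.iteratedDeriv_real {w : ℝ → ℝ} (hw : HasCompactSupport w) (s : ℕ) :
    HasCompactSupport (iteratedDeriv s w) := by
  induction s with
  | zero => simpa using hw
  | succ n ih => rw [iteratedDeriv_succ]; exact ih.deriv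

/-- Hardy's inequality for the operator `v ↦ x v' + (a + 1/2) v` on the half-line. -/
theorem sq_mul_integral_Ioi_sq_le {v : ℝ → ℝ} (hv : ContDiff ℝ 1 v) (hc : HasCompactSupport v)
    (a : ℝ) :
    a ^ 2 * ∫ x in Set.Ioi (0 : ℝ), v x ^ 2 ≤
      ∫ x in Set.Ioi (0 : ℝ), (x * deriv v x + (a + 1 / 2) * v x) ^ 2 := by
  have hv' : Continuous (deriv v) := hv.continuous_deriv le_rfl
  have hvc : Continuous v := hv.continuous
  have hint : ∀ g : ℝ → ℝ, Continuous g → (∀ x, v x = 0 → deriv v x = 0 → g x = 0) →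
      MeasureTheory.IntegrableOn g (Set.Ioi 0) := fun g hg h => by
    refine (hg.integrable_of_hasCompactSupport ?_).integrableOn
    refine HasCompactSupport.intro (hc.isCompact.union hc.deriv.isCompact) fun x hx => ?_
    simp only [Set.mem_union, not_or] at hx
    exact h x (image_eq_zero_of_notMem_tsupport hx.1) (image_eq_zero_of_notMem_tsupport hx.2)
  have hder : ∀ x, HasDerivAt (fun x => x * v x ^ 2) (v x ^ 2 + x * (2 * v x * deriv v x)) x :=
    fun x => by
      have h := (hasDerivAt_id' x).mul (((hv.differentiable one_ne_zero) x).hasDerivAt.pow 2)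
      refine h.congr_deriv ?_
      norm_num
  have hzero : ∫ x in Set.Ioi (0 : ℝ), (v x ^ 2 + x * (2 * v x * deriv v x)) = 0 := by
    have hcs : HasCompactSupport (fun x => x * v x ^ 2) :=
      HasCompactSupport.intro hc.isCompact fun x hx => by
        simp [image_eq_zero_of_notMem_tsupport hx]
    have h := hcs.integral_Ioi_deriv_eq (contDiff_id.mul (hv.pow 2)) 0
    simpa [fun x => (hder x).deriv] using h
  have hsq : MeasureTheory.IntegrableOn (fun x => v x ^ 2) (Set.Ioi 0) :=
    hint _ (by fun_prop) (fun x h _ => by simp [h])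
  have hdi : MeasureTheory.IntegrableOn
      (fun x => v x ^ 2 + x * (2 * v x * deriv v x)) (Set.Ioi 0) :=
    hint _ (by fun_prop) (fun x h _ => by simp [h])
  calc a ^ 2 * ∫ x in Set.Ioi (0 : ℝ), v x ^ 2
      = ∫ x in Set.Ioi (0 : ℝ),
          (a ^ 2 * v x ^ 2 + a * (v x ^ 2 + x * (2 * v x * deriv v x))) := by
        rw [MeasureTheory.integral_add (hsq.const_mul _) (hdi.const_mul _),
          MeasureTheory.integral_const_mul, MeasureTheory.integral_const_mul, hzero]
        ring
    _ ≤ _ := by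
        refine MeasureTheory.integral_mono ((hsq.const_mul _).add (hdi.const_mul _))
          (hint _ (by fun_prop) (fun x h h' => by simp [h, h'])) fun x => ?_
        have := sq_nonneg (x * deriv v x + v x / 2)
        dsimp only
        linarith

/-- one-dimensional Hardy-type inequality on `(0, ∞)`:
`(∫₀^∞ |w^{(s)}|²)^{1/2} ≤ (1/(s+1/2)) (∫₀^∞ |u^{(s+1)}|²)^{1/2}`. -/
theorem stmt2 (u : ℝ → ℝ) (hu : ContDiff ℝ (⊤ : ℕ∞) u) (hsupp : HasCompactSupport u)
    (hu0 : u 0 = 0) (w : ℝ → ℝ) (hwsmooth : ContDiff ℝ (⊤ : ℕ∞) w)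
    (hw : ∀ x : ℝ, x ≠ 0 → w x = u x / x) (hw0 : w 0 = deriv u 0) (s : ℕ) :
    Real.sqrt (∫ x in Set.Ioi (0:ℝ), (iteratedDeriv s w x) ^ 2) ≤
      (1 / ((s : ℝ) + 1 / 2)) *
        Real.sqrt (∫ x in Set.Ioi (0:ℝ), (iteratedDeriv (s + 1) u x) ^ 2) := by
  have hwc : HasCompactSupport w := by
    refine HasCompactSupport.intro (hsupp.isCompact.union (isCompact_singleton (x := 0)))
      fun x hx => ?_
    simp only [Set.mem_union, Set.mem_singleton_iff, not_or] at hx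
    rw [hw x hx.2, image_eq_zero_of_notMem_tsupport hx.1, zero_div]
  have huw : u = fun x => x * w x := by
    ext x
    rcases eq_or_ne x 0 with rfl | hx
    · simp [hu0]
    · rw [hw x hx, mul_div_cancel₀ _ hx]
  have hs : (0 : ℝ) < (s : ℝ) + 1 / 2 := by positivity
  have hv : ContDiff ℝ 1 (iteratedDeriv s w) := by
    rw [iteratedDeriv_eq_iterate]
    exact ContDiff.iterate_deriv' 1 s (hwsmooth.of_le (by exact_mod_cast le_top))
  have key := sq_mul_integral_Ioi_sq_le hv (hwc.iteratedDeriv_real s) ((s : ℝ) + 1 / 2)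
  have heq : ∀ x, iteratedDeriv (s + 1) u x =
      x * deriv (iteratedDeriv s w) x + ((s : ℝ) + 1 / 2 + 1 / 2) * iteratedDeriv s w x :=
    fun x => by
      rw [huw, iteratedDeriv_succ_id_mul hwsmooth, iteratedDeriv_succ]
      ring
  simp only [heq]
  rw [one_div, ← div_eq_inv_mul, le_div_iff₀ hs, mul_comm]
  refine Real.le_sqrt_of_sq_le ?_
  rwa [mul_pow, Real.sq_sqrt (MeasureTheory.integral_nonneg fun x => sq_nonneg _)]
end

section
/- Let u : ℝ → ℝ be a C^∞ function with compact support such that u(0) = 0, and let w : ℝ → ℝ be the C^∞ function with w(x) = u(x)/x for x ≠ 0 and w(0) = u'(0). Then for every integer s ≥ 0, ∫_ℝ |w^{(s)}(x)|² dx ≤ (1/(s + 1/2))² · ∫_ℝ |u^{(s+1)}(x)|² dx. -/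
theorem iteratedDeriv_succ_eq_of_eq_id_mul {u w : ℝ → ℝ} (hw : ContDiff ℝ (⊤ : ℕ∞) w)
    (h : ∀ x, u x = x * w x) (s : ℕ) (x : ℝ) :
    iteratedDeriv (s + 1) u x =
      x * iteratedDeriv (s + 1) w x + ((s : ℝ) + 1) * iteratedDeriv s w x := by
  have hd (n : ℕ) (y : ℝ) : HasDerivAt (iteratedDeriv n w) (iteratedDeriv (n + 1) w y) y := by
    rw [iteratedDeriv_succ]
    exact ((hw.differentiable_iteratedDeriv n (by exact_mod_cast WithTop.coe_lt_top _)) y).hasDerivAt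
  induction s generalizing x with
  | zero =>
    have h1 := (hasDerivAt_id x).mul (hd 0 x)
    have h2 : u = id * iteratedDeriv 0 w := by
      ext y
      simp [h y]
    rw [zero_add, iteratedDeriv_one, h2, h1.deriv]
    simp
    ring
  | succ n ih =>
    have h1 := ((hasDerivAt_id x).mul (hd (n + 1) x)).add ((hd n x).const_mul ((n : ℝ) + 1))
    have h2 : iteratedDeriv (n + 1) u =
        id * iteratedDeriv (n + 1) w + fun y ↦ ((n : ℝ) + 1) * iteratedDeriv n w y := by
      ext y
      simp [ih y]
    rw [iteratedDeriv_succ, h2, h1.deriv]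
    push_cast
    simp only [id]
    ring

theorem hasCompactSupport_iteratedDeriv {𝕜 F : Type*}
    [NontriviallyNormedField 𝕜] [NormedAddCommGroup F] [NormedSpace 𝕜 F] {f : 𝕜 → F}
    (hf : HasCompactSupport f) (n : ℕ) :
    HasCompactSupport (iteratedDeriv n f) := by
  induction n with
  | zero => simpa using hf
  | succ n ih =>
    rw [iteratedDeriv_succ]
    exact ih.deriv

open MeasureTheory in
/-- Hardy's inequality, with `x * deriv v x + (a + 1 / 2) * v x` in place of the derivative. -/
theorem sq_mul_integral_sq_le_integral_sq {v : ℝ → ℝ} (hv : ContDiff ℝ 1 v)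
    (hs : HasCompactSupport v) (a : ℝ) :
    a ^ 2 * ∫ x, v x ^ 2 ≤ ∫ x, (x * deriv v x + (a + 1 / 2) * v x) ^ 2 := by
  have hc := hv.continuous
  have hc' : Continuous (deriv v) := hv.continuous_deriv le_rfl
  have hs' : HasCompactSupport (deriv v) := hs.deriv
  have hint {f : ℝ → ℝ} (hf : Continuous f) (hz : ∀ x, v x = 0 → deriv v x = 0 → f x = 0) :
      Integrable f := by
    refine hf.integrable_of_hasCompactSupport
      (HasCompactSupport.intro (hs.isCompact.union hs'.isCompact) fun x hx ↦ ?_)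
    simp only [Set.mem_union, not_or] at hx
    exact hz x (image_eq_zero_of_notMem_tsupport hx.1) (image_eq_zero_of_notMem_tsupport hx.2)
  have hderiv (x : ℝ) :
      HasDerivAt (fun y ↦ y * v y ^ 2) (v x ^ 2 + 2 * x * v x * deriv v x) x := by
    refine ((hasDerivAt_id' x).fun_mul
      (((hv.differentiable one_ne_zero) x).hasDerivAt.fun_pow 2)).congr_deriv ?_
    push_cast
    ring
  have hDint : Integrable fun x ↦ v x ^ 2 + 2 * x * v x * deriv v x :=
    hint (by fun_prop) fun x h h' ↦ by simp [h, h']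
  have hD : ∫ x, (v x ^ 2 + 2 * x * v x * deriv v x) = 0 :=
    integral_eq_zero_of_hasDerivAt_of_integrable hderiv hDint
      (hint (by fun_prop) fun x h h' ↦ by simp [h])
  have hv2 : Integrable fun x ↦ v x ^ 2 := hint (by fun_prop) fun x h h' ↦ by simp [h]
  have hg2 : Integrable fun x ↦ (x * deriv v x + (a + 1 / 2) * v x) ^ 2 :=
    hint (by fun_prop) fun x h h' ↦ by simp [h, h']
  calc a ^ 2 * ∫ x, v x ^ 2
      = ∫ x, (a ^ 2 * v x ^ 2 + a * (v x ^ 2 + 2 * x * v x * deriv v x)) := by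
        rw [integral_add (hv2.const_mul _) (hDint.const_mul _), integral_const_mul,
          integral_const_mul, hD, mul_zero, add_zero]
    _ ≤ ∫ x, (x * deriv v x + (a + 1 / 2) * v x) ^ 2 := by
        refine integral_mono ((hv2.const_mul _).add (hDint.const_mul _)) hg2 fun x ↦ ?_
        have := sq_nonneg (x * deriv v x + 1 / 2 * v x)
        simp only
        linarith

/-- one-dimensional Hardy-type inequality on all of `ℝ`:
`∫_ℝ |w^{(s)}|² ≤ (1/(s+1/2))² ∫_ℝ |u^{(s+1)}|²`. -/
theorem stmt3 (u : ℝ → ℝ) (hu : ContDiff ℝ (⊤ : ℕ∞) u) (hsupp : HasCompactSupport u)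
    (hu0 : u 0 = 0) (w : ℝ → ℝ) (hwsmooth : ContDiff ℝ (⊤ : ℕ∞) w)
    (hw : ∀ x : ℝ, x ≠ 0 → w x = u x / x) (hw0 : w 0 = deriv u 0) (s : ℕ) :
    ∫ x : ℝ, (iteratedDeriv s w x) ^ 2 ≤
      (1 / ((s : ℝ) + 1 / 2)) ^ 2 * ∫ x : ℝ, (iteratedDeriv (s + 1) u x) ^ 2 := by
  have huw (x : ℝ) : u x = x * w x := by
    rcases eq_or_ne x 0 with rfl | hx
    · simp [hu0]
    · rw [hw x hx]
      field_simp
  have hwsupp : HasCompactSupport w := by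
    refine HasCompactSupport.intro (hsupp.isCompact.union (isCompact_singleton (x := 0)))
      fun x hx ↦ ?_
    simp only [Set.mem_union, Set.mem_singleton_iff, not_or] at hx
    rw [hw x hx.2, image_eq_zero_of_notMem_tsupport hx.1, zero_div]
  have hv : ContDiff ℝ 1 (iteratedDeriv s w) := by
    rw [iteratedDeriv_eq_iterate]
    exact (hwsmooth.iterate_deriv s).of_le (by exact_mod_cast le_top)
  have key := sq_mul_integral_sq_le_integral_sq hv (hasCompactSupport_iteratedDeriv hwsupp s)
    ((s : ℝ) + 1 / 2)
  have hg (x : ℝ) : iteratedDeriv (s + 1) u x = x * deriv (iteratedDeriv s w) x +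
      ((s : ℝ) + 1 / 2 + 1 / 2) * iteratedDeriv s w x := by
    rw [iteratedDeriv_succ_eq_of_eq_id_mul hwsmooth huw, iteratedDeriv_succ]
    ring
  simp only [hg]
  rw [one_div, inv_pow, ← div_eq_inv_mul, le_div_iff₀' (by positivity)]
  exact key
end

section
/- Let u : ℝ² → ℝ be a C^∞ function with compact support such that u(x, 0) = 0 for all x ∈ ℝ, and let w : ℝ² → ℝ be a C^∞ function such that u(x, y) = y·w(x, y) for all (x, y) ∈ ℝ². Then for all integers t, s ≥ 0, (∫_{ℝ²} |∂ₓᵗ∂_y^s w|² dx dy)^{1/2} ≤ (1/(s + 1/2)) · (∫_{ℝ²} |∂ₓᵗ∂_y^{s+1} u|² dx dy)^{1/2}, where ∂ₓᵗ∂_y^s denotes the mixed partial derivative of order t in the first variable and order s in the second variable. -/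
open MeasureTheory

/-- Mixed partial derivative of order `t` in the first variable and order `s` in the
second variable of a function `f : ℝ × ℝ → ℝ`. -/
noncomputable def mixedPartial (t s : ℕ) (f : ℝ × ℝ → ℝ) : ℝ × ℝ → ℝ :=
  fun p => iteratedDeriv t (fun x => iteratedDeriv s (fun y => f (x, y)) p.2) p.1

/-- The derivative of `f` in the direction `v`. -/
noncomputable def dirDeriv (v : ℝ × ℝ) (f : ℝ × ℝ → ℝ) : ℝ × ℝ → ℝ :=
  fun p => fderiv ℝ f p v

section dirDeriv

variable {f g : ℝ × ℝ → ℝ}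

theorem ContDiff.dirDeriv (hf : ContDiff ℝ (⊤ : ℕ∞) f) (v : ℝ × ℝ) :
    ContDiff ℝ (⊤ : ℕ∞) (dirDeriv v f) :=
  (hf.fderiv_right (m := (⊤ : ℕ∞)) (by simp)).clm_apply contDiff_const

theorem ContDiff.iterate_dirDeriv (hf : ContDiff ℝ (⊤ : ℕ∞) f) (v : ℝ × ℝ) (n : ℕ) :
    ContDiff ℝ (⊤ : ℕ∞) ((_root_.dirDeriv v)^[n] f) := by
  induction n with
  | zero => exact hf
  | succ n ih => rw [Function.iterate_succ_apply']; exact ih.dirDeriv v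

theorem HasCompactSupport.iterate_dirDeriv (hf : HasCompactSupport f) (v : ℝ × ℝ) (n : ℕ) :
    HasCompactSupport ((dirDeriv v)^[n] f) := by
  induction n with
  | zero => exact hf
  | succ n ih => rw [Function.iterate_succ_apply']; exact ih.fderiv_apply (𝕜 := ℝ) v

theorem dirDeriv_comm (hf : ContDiff ℝ (⊤ : ℕ∞) f) (v w : ℝ × ℝ) :
    dirDeriv v (dirDeriv w f) = dirDeriv w (dirDeriv v f) := by
  have hd : Differentiable ℝ (fderiv ℝ f) :=
    (hf.fderiv_right (m := (⊤ : ℕ∞)) (by simp)).differentiable (by simp)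
  ext p
  have key (a b : ℝ × ℝ) :
      dirDeriv a (dirDeriv b f) p = fderiv ℝ (fderiv ℝ f) p a b := by
    change fderiv ℝ (fun q => fderiv ℝ f q b) p a = _
    rw [fderiv_clm_apply (hd p) (differentiableAt_const b)]
    simp
  rw [key, key]
  refine hf.contDiffAt.isSymmSndFDerivAt ?_ v w
  simp only [minSmoothness_of_isRCLikeNormedField]
  exact WithTop.coe_le_coe.2 (le_top : (2 : ℕ∞) ≤ ⊤)

theorem dirDeriv_iterate_comm (hf : ContDiff ℝ (⊤ : ℕ∞) f) (v w : ℝ × ℝ) (n : ℕ) :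
    dirDeriv v ((dirDeriv w)^[n] f) = (dirDeriv w)^[n] (dirDeriv v f) := by
  induction n with
  | zero => rfl
  | succ n ih =>
    rw [Function.iterate_succ_apply', Function.iterate_succ_apply',
      dirDeriv_comm (hf.iterate_dirDeriv w n), ih]

theorem dirDeriv_snd_mul_add (hf : ContDiff ℝ (⊤ : ℕ∞) f) (hg : ContDiff ℝ (⊤ : ℕ∞) g)
    (v : ℝ × ℝ) (c : ℝ) :
    dirDeriv v (fun p => p.2 * f p + c * g p) =
      fun p => p.2 * dirDeriv v f p + v.2 * f p + c * dirDeriv v g p := by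
  ext p
  have hf' := (hf.differentiable (by simp) p).hasFDerivAt
  have hg' := (hg.differentiable (by simp) p).hasFDerivAt
  have h := ((hasFDerivAt_snd (𝕜 := ℝ) (p := p)).mul hf').add (hg'.const_mul c)
  refine (congrArg (· v) h.fderiv).trans ?_
  simp [dirDeriv]
  ring

theorem iterate_dirDeriv_snd_mul (hf : ContDiff ℝ (⊤ : ℕ∞) f) (s : ℕ) :
    (dirDeriv (0, 1))^[s + 1] (fun p => p.2 * f p) =
      fun p => p.2 * (dirDeriv (0, 1))^[s + 1] f p +
        ((s : ℝ) + 1) * (dirDeriv (0, 1))^[s] f p := by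
  induction s with
  | zero =>
    have h := dirDeriv_snd_mul_add hf hf (0, 1) 0
    simpa using h
  | succ s ih =>
    rw [Function.iterate_succ_apply', ih, dirDeriv_snd_mul_add (hf.iterate_dirDeriv _ _)
      (hf.iterate_dirDeriv _ _)]
    ext p
    simp only [Function.iterate_succ_apply']
    push_cast
    ring

theorem iterate_dirDeriv_fst_snd_mul_add (hf : ContDiff ℝ (⊤ : ℕ∞) f)
    (hg : ContDiff ℝ (⊤ : ℕ∞) g) (c : ℝ) (t : ℕ) :
    (dirDeriv (1, 0))^[t] (fun p => p.2 * f p + c * g p) =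
      fun p => p.2 * (dirDeriv (1, 0))^[t] f p + c * (dirDeriv (1, 0))^[t] g p := by
  induction t with
  | zero => rfl
  | succ t ih =>
    rw [Function.iterate_succ_apply', ih, dirDeriv_snd_mul_add (hf.iterate_dirDeriv _ _)
      (hg.iterate_dirDeriv _ _)]
    ext p
    simp only [Function.iterate_succ_apply']
    ring

theorem iteratedDeriv_fst_eq (hf : ContDiff ℝ (⊤ : ℕ∞) f) (n : ℕ) (y : ℝ) :
    iteratedDeriv n (fun x => f (x, y)) = fun x => (dirDeriv (1, 0))^[n] f (x, y) := by
  induction n with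
  | zero => simp
  | succ n ih =>
    ext x
    rw [iteratedDeriv_succ, ih, Function.iterate_succ_apply']
    have h := ((hf.iterate_dirDeriv (1, 0) n).differentiable (by simp) (x, y)).hasFDerivAt
    exact (h.comp_hasDerivAt x ((hasDerivAt_id x).prodMk (hasDerivAt_const x y))).deriv

theorem iteratedDeriv_snd_eq (hf : ContDiff ℝ (⊤ : ℕ∞) f) (n : ℕ) (x : ℝ) :
    iteratedDeriv n (fun y => f (x, y)) = fun y => (dirDeriv (0, 1))^[n] f (x, y) := by
  induction n with
  | zero => simp
  | succ n ih =>
    ext y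
    rw [iteratedDeriv_succ, ih, Function.iterate_succ_apply']
    have h := ((hf.iterate_dirDeriv (0, 1) n).differentiable (by simp) (x, y)).hasFDerivAt
    exact (h.comp_hasDerivAt y ((hasDerivAt_const y x).prodMk (hasDerivAt_id y))).deriv

theorem mixedPartial_eq_iterate_dirDeriv (hf : ContDiff ℝ (⊤ : ℕ∞) f) (t s : ℕ) :
    mixedPartial t s f = (dirDeriv (1, 0))^[t] ((dirDeriv (0, 1))^[s] f) := by
  ext ⟨x, y⟩
  simp only [mixedPartial, iteratedDeriv_snd_eq hf,
    iteratedDeriv_fst_eq (hf.iterate_dirDeriv (0, 1) s)]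

/-- A weighted Hardy inequality: `(s + 1/2)² ‖f‖² ≤ ‖y ∂_y f + (s + 1) f‖²` in `L²(ℝ²)`. -/
theorem integral_sq_le_integral_snd_mul_dirDeriv_add_sq (hf : ContDiff ℝ (⊤ : ℕ∞) f)
    (hc : HasCompactSupport f) (s : ℝ) :
    (s + 1 / 2) ^ 2 * ∫ p, f p ^ 2 ≤
      ∫ p : ℝ × ℝ, (p.2 * dirDeriv (0, 1) f p + (s + 1) * f p) ^ 2 := by
  have cf : Continuous f := hf.continuous
  have cd : Continuous (dirDeriv (0, 1) f) := (hf.dirDeriv _).continuous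
  have hsupp {h : ℝ × ℝ → ℝ} (ch : Continuous h) : Integrable (fun p => h p * f p) :=
    (ch.mul cf).integrable_of_hasCompactSupport hc.mul_left
  have hcd : HasCompactSupport (dirDeriv (0, 1) f) := hc.fderiv_apply (𝕜 := ℝ) _
  have hdf : dirDeriv (0, 1) (fun p : ℝ × ℝ => p.2 * f p) =
      fun p => p.2 * dirDeriv (0, 1) f p + f p := by
    simpa using dirDeriv_snd_mul_add hf hf (0, 1) 0
  have isq : Integrable (fun p => f p ^ 2) := by
    simpa only [sq] using hsupp cf
  have iyff : Integrable (fun p : ℝ × ℝ => p.2 * dirDeriv (0, 1) f p * f p) :=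
    hsupp (continuous_snd.mul cd)
  have idd : Integrable (fun p : ℝ × ℝ => p.2 ^ 2 * dirDeriv (0, 1) f p ^ 2) := by
    have : Integrable
        (fun p : ℝ × ℝ => (p.2 ^ 2 * dirDeriv (0, 1) f p) * dirDeriv (0, 1) f p) :=
      (((continuous_snd.pow 2).mul cd).mul cd).integrable_of_hasCompactSupport hcd.mul_left
    exact this.congr (.of_forall fun p => by ring)
  have hparts : ∫ p : ℝ × ℝ, p.2 * dirDeriv (0, 1) f p * f p =
      -∫ p : ℝ × ℝ, (p.2 * dirDeriv (0, 1) f p * f p + f p ^ 2) := by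
    have h := integral_mul_fderiv_eq_neg_fderiv_mul_of_integrable (μ := (volume : Measure (ℝ × ℝ)))
      (𝕜 := ℝ) (f := fun p : ℝ × ℝ => p.2 * f p) (g := f) (v := (0, 1))
      (hsupp (((contDiff_snd.mul hf).dirDeriv (0, 1)).continuous))
      (iyff.congr (.of_forall fun p => by simp only [dirDeriv]; ring))
      (hsupp (continuous_snd.mul cf))
      (fun p _ => (contDiff_snd.mul hf).differentiable (by simp) p)
      (fun p _ => hf.differentiable (by simp) p)
    refine (integral_congr_ae (.of_forall fun p => ?_)).trans
      (h.trans (congrArg Neg.neg (integral_congr_ae (.of_forall fun p => ?_))))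
    · simp only [dirDeriv]
      ring
    · have := congrFun hdf p
      simp only [dirDeriv] at this ⊢
      rw [this]
      ring
  rw [integral_add iyff isq] at hparts
  have hnonneg : 0 ≤ ∫ p : ℝ × ℝ, (p.2 * dirDeriv (0, 1) f p + 1 / 2 * f p) ^ 2 :=
    integral_nonneg fun p => sq_nonneg _
  have hexpand (c : ℝ) : ∫ p : ℝ × ℝ, (p.2 * dirDeriv (0, 1) f p + c * f p) ^ 2 =
      (∫ p : ℝ × ℝ, p.2 ^ 2 * dirDeriv (0, 1) f p ^ 2) +
        2 * c * (∫ p : ℝ × ℝ, p.2 * dirDeriv (0, 1) f p * f p) + c ^ 2 * ∫ p, f p ^ 2 := by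
    rw [← integral_const_mul, ← integral_const_mul, ← integral_add idd (iyff.const_mul _),
      ← integral_add (by exact idd.add (iyff.const_mul _)) (isq.const_mul _)]
    refine integral_congr_ae (.of_forall fun p => ?_)
    simp only
    ring
  rw [hexpand] at hnonneg ⊢
  have hcross : ∫ p : ℝ × ℝ, p.2 * dirDeriv (0, 1) f p * f p = -(1 / 2) * ∫ p, f p ^ 2 := by
    linarith
  rw [hcross] at hnonneg ⊢
  nlinarith

end dirDeriv

theorem HasCompactSupport.of_snd_mul {w : ℝ × ℝ → ℝ} (hw : Continuous w)
    (h : HasCompactSupport fun p : ℝ × ℝ => p.2 * w p) : HasCompactSupport w := by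
  refine h.mono' ?_
  have hd : Dense (Prod.snd ⁻¹' {0}ᶜ : Set (ℝ × ℝ)) :=
    (dense_compl_singleton (0 : ℝ)).preimage isOpenMap_snd
  refine (hd.open_subset_closure_inter hw.isOpen_support).trans (closure_mono ?_)
  rintro p ⟨hp, hp'⟩
  exact mul_ne_zero hp' hp

/-- two-dimensional Hardy-type inequality: if `u` is smooth with compact
support, vanishing on `{y = 0}`, and `w` is smooth with `u(x,y) = y·w(x,y)`, then
`‖∂ₓᵗ∂_y^s w‖_{L²(ℝ²)} ≤ (1/(s+1/2)) ‖∂ₓᵗ∂_y^{s+1} u‖_{L²(ℝ²)}`. -/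
theorem stmt5 (u : ℝ × ℝ → ℝ) (hu : ContDiff ℝ (⊤ : ℕ∞) u) (hsupp : HasCompactSupport u)
    (hu0 : ∀ x : ℝ, u (x, 0) = 0) (w : ℝ × ℝ → ℝ) (hw : ContDiff ℝ (⊤ : ℕ∞) w)
    (huw : ∀ x y : ℝ, u (x, y) = y * w (x, y)) (t s : ℕ) :
    Real.sqrt (∫ p : ℝ × ℝ, (mixedPartial t s w p) ^ 2) ≤
      (1 / ((s : ℝ) + 1 / 2)) *
        Real.sqrt (∫ p : ℝ × ℝ, (mixedPartial t (s + 1) u p) ^ 2) := by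
  obtain rfl : u = fun p => p.2 * w p := funext fun p => huw p.1 p.2
  have hws := hw.iterate_dirDeriv (0, 1) s
  have key := integral_sq_le_integral_snd_mul_dirDeriv_add_sq (hws.iterate_dirDeriv (1, 0) t)
    (((hsupp.of_snd_mul hw.continuous).iterate_dirDeriv (0, 1) s).iterate_dirDeriv (1, 0) t) s
  rw [dirDeriv_iterate_comm hws, ← Function.iterate_succ_apply' (dirDeriv (0, 1))] at key
  rw [mixedPartial_eq_iterate_dirDeriv hw, mixedPartial_eq_iterate_dirDeriv hu,
    iterate_dirDeriv_snd_mul hw,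
    iterate_dirDeriv_fst_snd_mul_add (hw.iterate_dirDeriv _ _) hws]
  have hs : (0 : ℝ) < s + 1 / 2 := by positivity
  rw [one_div_mul_eq_div, le_div_iff₀' hs]
  refine Real.le_sqrt_of_sq_le ?_
  rw [mul_pow, Real.sq_sqrt (integral_nonneg fun p => sq_nonneg _)]
  exact key
end

section
/- Let p be a real polynomial in two variables X and Y such that: (i) p(x, 0) = 0 for all x ∈ ℝ; (ii) (∂p/∂Y)(x, 0) = 0 for all x ∈ ℝ; and (iii) p is harmonic, i.e. ∂²p/∂X² + ∂²p/∂Y² = 0 as a polynomial. Then p is the zero polynomial. -/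
open MvPolynomial Finsupp in
/-- Setting the second variable to zero keeps exactly the coefficients of pure powers of the
first variable. -/
lemma coeff_aeval_X_zero {R : Type*} [CommSemiring R] (p : MvPolynomial (Fin 2) R) (a : ℕ) :
    (aeval ![(Polynomial.X : Polynomial R), 0] p).coeff a = coeff (single 0 a) p := by
  induction p using MvPolynomial.induction_on' with
  | monomial m r =>
    have hm : m = single 0 a ↔ m 0 = a ∧ m 1 = 0 := by
      simp [Finsupp.ext_iff, Fin.forall_fin_two]
    rw [aeval_monomial, Finsupp.prod_fintype _ _ (by simp), coeff_monomial]
    simp only [hm, Fin.prod_univ_two, Matrix.cons_val_zero, Matrix.cons_val_one,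
      Polynomial.algebraMap_eq]
    rw [Polynomial.coeff_C_mul]
    by_cases h1 : m 1 = 0
    · simp [h1, Polynomial.coeff_X_pow, eq_comm]
    · simp [h1]
  | add p q hp hq => simp [hp, hq]

open MvPolynomial Finsupp in
/-- A polynomial in two variables vanishing on the first axis has no pure powers of the first
variable. -/
lemma coeff_single_zero_of_eval_eq_zero {R : Type*} [CommRing R] [IsDomain R] [Infinite R]
    {p : MvPolynomial (Fin 2) R} (hp : ∀ x : R, eval ![x, 0] p = 0) (a : ℕ) :
    coeff (single 0 a) p = 0 := by
  have h : aeval ![(Polynomial.X : Polynomial R), 0] p = 0 := by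
    refine Polynomial.funext fun x => ?_
    have hx : (Polynomial.aeval x).comp (aeval ![(Polynomial.X : Polynomial R), 0]) =
        aeval ![x, 0] := by
      ext i
      fin_cases i <;> simp
    have := DFunLike.congr_fun hx p
    simpa [Polynomial.coe_aeval_eq_eval, coe_aeval_eq_eval, hp] using this
  rw [← coeff_aeval_X_zero, h, Polynomial.coeff_zero]


/-- if `p ∈ ℝ[X, Y]` satisfies `p(x, 0) = 0` and `(∂p/∂Y)(x, 0) = 0` for all
real `x`, and is harmonic (`∂²p/∂X² + ∂²p/∂Y² = 0` formally), then `p = 0`. -/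
theorem stmt9 (p : MvPolynomial (Fin 2) ℝ)
    (hp0 : ∀ x : ℝ, MvPolynomial.eval ![x, 0] p = 0)
    (hpy0 : ∀ x : ℝ, MvPolynomial.eval ![x, 0] (MvPolynomial.pderiv 1 p) = 0)
    (hharm : MvPolynomial.pderiv 0 (MvPolynomial.pderiv 0 p) +
      MvPolynomial.pderiv 1 (MvPolynomial.pderiv 1 p) = 0) :
    p = 0 := by
  have key (n : ℕ) : ∀ a : ℕ,
      MvPolynomial.coeff (Finsupp.single 0 a + Finsupp.single 1 n) p = 0 := by
    induction n using Nat.strong_induction_on with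
    | _ n ih =>
      intro a
      match n with
      | 0 => simpa using coeff_single_zero_of_eval_eq_zero hp0 a
      | 1 =>
        simpa [MvPolynomial.coeff_pderiv] using coeff_single_zero_of_eval_eq_zero hpy0 a
      | n + 2 =>
        have h := congrArg
          (MvPolynomial.coeff (Finsupp.single 0 a + Finsupp.single 1 n)) hharm
        have hX : (Finsupp.single 0 a + Finsupp.single 1 n + Finsupp.single 0 1 +
            Finsupp.single 0 1 : Fin 2 →₀ ℕ) =
            Finsupp.single 0 (a + 2) + Finsupp.single 1 n := by
          ext i
          fin_cases i <;> simp
        have hY : (Finsupp.single 0 a + Finsupp.single 1 n + Finsupp.single 1 1 +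
            Finsupp.single 1 1 : Fin 2 →₀ ℕ) =
            Finsupp.single 0 a + Finsupp.single 1 (n + 2) := by
          ext i
          fin_cases i <;> simp
        rw [MvPolynomial.coeff_add] at h
        simp only [MvPolynomial.coeff_pderiv, hX, hY, ih n (by omega) (a + 2), zero_mul,
          zero_add, MvPolynomial.coeff_zero] at h
        refine (mul_eq_zero.mp ((mul_eq_zero.mp h).resolve_right ?_)).resolve_right ?_
        all_goals exact Nat.cast_add_one_ne_zero _
  ext m
  have hm : m = Finsupp.single 0 (m 0) + Finsupp.single 1 (m 1) := by
    ext i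
    fin_cases i <;> simp
  rw [hm, key, MvPolynomial.coeff_zero]
end

section
/- Let p : ℝ² → ℝ be a polynomial function, let A, B ∈ ℝ² with A ≠ B, and let n ∈ ℝ² be a nonzero vector orthogonal to B − A. Suppose that p vanishes at every point of the segment [A, B], that the directional derivative of p in the direction n vanishes at every point of the segment [A, B], and that p is harmonic on ℝ² (its Laplacian ∂²p/∂x² + ∂²p/∂y² is identically zero). Then p is identically zero on ℝ². -/
namespace MvPolynomial

theorem pderiv_comm {σ R : Type*} [CommRing R] (i j : σ) (q : MvPolynomial σ R) :
    pderiv i (pderiv j q) = pderiv j (pderiv i q) := by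
  classical
  have h : ⁅(pderiv i : Derivation R (MvPolynomial σ R) (MvPolynomial σ R)),
      (pderiv j : Derivation R (MvPolynomial σ R) (MvPolynomial σ R))⁆ = 0 := by
    ext k
    simp [Derivation.commutator_apply, pderiv_X, Pi.single_apply, apply_ite]
  have := congrArg (fun D => D q) h
  simpa [Derivation.commutator_apply, sub_eq_zero] using this

theorem eq_C_of_forall_pderiv_eq_zero {σ R : Type*} [CommRing R] [NoZeroDivisors R] [CharZero R]
    {q : MvPolynomial σ R} (h : ∀ i, pderiv i q = 0) : q = C (coeff 0 q) := by
  classical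
  ext m
  rw [coeff_C]
  split_ifs with hm
  · rw [hm]
  · obtain ⟨i, hi⟩ := DFunLike.ne_iff.mp (Ne.symm hm)
    have hle : Finsupp.single i 1 ≤ m :=
      Finsupp.single_le_iff.mpr (Nat.one_le_iff_ne_zero.mpr hi)
    have hc := coeff_pderiv (i := i) q (m - Finsupp.single i 1)
    rw [h i, tsub_add_cancel_of_le hle, coeff_zero] at hc
    exact (mul_eq_zero.mp hc.symm).resolve_right (by norm_cast)

/-- A collection of polynomials that is stable under all partial derivatives and contains no nonzero
constant contains no nonzero polynomial. -/
theorem eq_zero_of_pderiv_stable {σ R : Type*} [CommRing R] [NoZeroDivisors R] [CharZero R]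
    {S : MvPolynomial σ R → Prop} (hS : ∀ q, S q → ∀ i, S (pderiv i q))
    (hC : ∀ c, S (C c) → c = 0) {q : MvPolynomial σ R} (hq : S q) : q = 0 := by
  suffices H : ∀ (N : ℕ) (q : MvPolynomial σ R), (∀ m : σ →₀ ℕ, N ≤ m.degree → coeff m q = 0) →
      S q → q = 0 by
    refine H (q.totalDegree + 1) q (fun m hm => coeff_eq_zero_of_totalDegree_lt ?_) hq
    exact hm
  intro N
  induction N with
  | zero => exact fun q h _ => by ext m; simpa using h m (Nat.zero_le _)
  | succ N ih =>
    intro q h hq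
    have hconst : q = C (coeff 0 q) := eq_C_of_forall_pderiv_eq_zero fun i =>
      ih _ (fun m hm => by rw [coeff_pderiv, h _ (by simpa using hm), zero_mul]) (hS q hq i)
    rw [hconst] at hq
    rw [hconst, hC _ hq, C_0]

theorem hasDerivAt_eval_line (q : MvPolynomial (Fin 2) ℝ) (a b v w t : ℝ) :
    HasDerivAt (fun t : ℝ => eval ![a + t * v, b + t * w] q)
      (v * eval ![a + t * v, b + t * w] (pderiv 0 q) +
        w * eval ![a + t * v, b + t * w] (pderiv 1 q)) t := by
  have line (a v : ℝ) : HasDerivAt (fun t : ℝ => a + t * v) v t := by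
    simpa using ((hasDerivAt_id t).mul_const v).const_add a
  induction q using MvPolynomial.induction_on with
  | C c => simpa using hasDerivAt_const t c
  | add p q hp hq =>
    simp only [map_add]
    exact (hp.add hq).congr_deriv (by ring)
  | mul_X p i hp =>
    simp only [map_mul, eval_X, Derivation.leibniz, map_add, smul_eq_mul]
    fin_cases i
    · refine (hp.mul (line a v)).congr_deriv ?_
      simp [pderiv_X]
      ring
    · refine (hp.mul (line b w)).congr_deriv ?_
      simp [pderiv_X]
      ring

theorem iteratedDeriv_two_eval_fst (q : MvPolynomial (Fin 2) ℝ) (x y : ℝ) :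
    iteratedDeriv 2 (fun x => eval ![x, y] q) x = eval ![x, y] (pderiv 0 (pderiv 0 q)) := by
  have h (q : MvPolynomial (Fin 2) ℝ) :
      deriv (fun x => eval ![x, y] q) = fun x => eval ![x, y] (pderiv 0 q) := by
    funext x
    simpa using (hasDerivAt_eval_line q 0 y 1 0 x).deriv
  rw [iteratedDeriv_succ, iteratedDeriv_one, h, h]

theorem iteratedDeriv_two_eval_snd (q : MvPolynomial (Fin 2) ℝ) (x y : ℝ) :
    iteratedDeriv 2 (fun y => eval ![x, y] q) y = eval ![x, y] (pderiv 1 (pderiv 1 q)) := by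
  have h (q : MvPolynomial (Fin 2) ℝ) :
      deriv (fun y => eval ![x, y] q) = fun y => eval ![x, y] (pderiv 1 q) := by
    funext y
    simpa using (hasDerivAt_eval_line q x 0 0 1 y).deriv
  rw [iteratedDeriv_succ, iteratedDeriv_one, h, h]

theorem tangential_deriv_eq_zero {q : MvPolynomial (Fin 2) ℝ} {a b v w : ℝ}
    (h : ∀ t ∈ Set.Ioo (0 : ℝ) 1, eval ![a + t * v, b + t * w] q = 0) :
    ∀ t ∈ Set.Ioo (0 : ℝ) 1, v * eval ![a + t * v, b + t * w] (pderiv 0 q) +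
      w * eval ![a + t * v, b + t * w] (pderiv 1 q) = 0 := fun t ht =>
  (hasDerivAt_eval_line q a b v w t).unique <| (hasDerivAt_const t (0 : ℝ)).congr_of_eventuallyEq <|
    Filter.eventually_of_mem (isOpen_Ioo.mem_nhds ht) h

end MvPolynomial

theorem eq_zero_of_rotation_system {v w x y : ℝ} (hvw : v ≠ 0 ∨ w ≠ 0)
    (h₁ : v * x + w * y = 0) (h₂ : v * y - w * x = 0) : x = 0 ∧ y = 0 := by
  have hpos : v ^ 2 + w ^ 2 ≠ 0 := by
    rcases hvw with h | h <;> positivity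
  exact ⟨(mul_eq_zero.mp (by linear_combination v * h₁ - w * h₂ :
      (v ^ 2 + w ^ 2) * x = 0)).resolve_left hpos,
    (mul_eq_zero.mp (by linear_combination w * h₁ + v * h₂ :
      (v ^ 2 + w ^ 2) * y = 0)).resolve_left hpos⟩

open MvPolynomial in
theorem MvPolynomial.eq_zero_of_harmonic_of_cauchy_data {q : MvPolynomial (Fin 2) ℝ} {a b v w : ℝ}
    (hvw : v ≠ 0 ∨ w ≠ 0) (hharm : pderiv 0 (pderiv 0 q) + pderiv 1 (pderiv 1 q) = 0)
    (h : ∀ t ∈ Set.Ioo (0 : ℝ) 1, eval ![a + t * v, b + t * w] q = 0)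
    (hgrad : ∀ i, ∀ t ∈ Set.Ioo (0 : ℝ) 1, eval ![a + t * v, b + t * w] (pderiv i q) = 0) :
    q = 0 := by
  refine eq_zero_of_pderiv_stable (S := fun q =>
    pderiv 0 (pderiv 0 q) + pderiv 1 (pderiv 1 q) = 0 ∧
    (∀ t ∈ Set.Ioo (0 : ℝ) 1, eval ![a + t * v, b + t * w] q = 0) ∧
    ∀ i, ∀ t ∈ Set.Ioo (0 : ℝ) 1, eval ![a + t * v, b + t * w] (pderiv i q) = 0)
    ?_ ?_ ⟨hharm, h, hgrad⟩
  · rintro q ⟨hharm, -, hgrad⟩ i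
    refine ⟨?_, hgrad i, ?_⟩
    · simpa only [map_add, map_zero, pderiv_comm i] using congrArg (pderiv i) hharm
    · have key : ∀ t ∈ Set.Ioo (0 : ℝ) 1,
          eval ![a + t * v, b + t * w] (pderiv 0 (pderiv 0 q)) = 0 ∧
          eval ![a + t * v, b + t * w] (pderiv 0 (pderiv 1 q)) = 0 := by
        intro t ht
        have h₀ := tangential_deriv_eq_zero (hgrad 0) t ht
        have h₁ := tangential_deriv_eq_zero (hgrad 1) t ht
        have h₂ := congrArg (eval ![a + t * v, b + t * w]) hharm
        rw [pderiv_comm 1 0] at h₀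
        rw [map_add, map_zero] at h₂
        exact eq_zero_of_rotation_system hvw h₀ (by linear_combination h₁ - w * h₂)
      intro j t ht
      obtain ⟨h₀, h₁⟩ := key t ht
      have h₂ := congrArg (eval ![a + t * v, b + t * w]) hharm
      rw [map_add, map_zero, h₀, zero_add] at h₂
      fin_cases i <;> fin_cases j
      exacts [h₀, (congrArg _ (pderiv_comm 1 0 q)).trans h₁, h₁, h₂]
  · rintro c ⟨-, hc, -⟩
    simpa using hc (1 / 2) (by norm_num)


/-- let `p : ℝ² → ℝ` be a polynomial function, `A ≠ B` points of `ℝ²`, and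
`n ≠ 0` a vector orthogonal to `B - A`. If `p` vanishes on the segment `[A, B]`, the
directional derivative of `p` in the direction `n` vanishes on `[A, B]`, and `p` is
harmonic on `ℝ²`, then `p` is identically zero. -/
theorem stmt10 (p : ℝ × ℝ → ℝ)
    (hpoly : ∃ q : MvPolynomial (Fin 2) ℝ, ∀ z : ℝ × ℝ, p z = MvPolynomial.eval ![z.1, z.2] q)
    (A B : ℝ × ℝ) (hAB : A ≠ B) (n : ℝ × ℝ) (hn : n ≠ 0)
    (horth : n.1 * (B.1 - A.1) + n.2 * (B.2 - A.2) = 0)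
    (hvanish : ∀ z ∈ segment ℝ A B, p z = 0)
    (hnormal : ∀ z ∈ segment ℝ A B, deriv (fun t : ℝ => p (z + t • n)) 0 = 0)
    (hharm : ∀ z : ℝ × ℝ,
      iteratedDeriv 2 (fun x => p (x, z.2)) z.1 + iteratedDeriv 2 (fun y => p (z.1, y)) z.2 = 0) :
    ∀ z : ℝ × ℝ, p z = 0 := by
  obtain ⟨q, hq⟩ := hpoly
  suffices q = 0 by
    intro z
    rw [hq, this, map_zero]
  set v := B.1 - A.1
  set w := B.2 - A.2
  have hvw : v ≠ 0 ∨ w ≠ 0 := by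
    by_contra! H
    exact hAB (Prod.ext (sub_eq_zero.mp H.1).symm (sub_eq_zero.mp H.2).symm)
  have hn' : n.1 ≠ 0 ∨ n.2 ≠ 0 := by
    by_contra! H
    exact hn (Prod.ext H.1 H.2)
  have hseg : ∀ t ∈ Set.Ioo (0 : ℝ) 1, (A.1 + t * v, A.2 + t * w) ∈ segment ℝ A B := by
    intro t ht
    rw [segment_eq_image']
    exact ⟨t, Set.Ioo_subset_Icc_self ht, rfl⟩
  have hzero : ∀ t ∈ Set.Ioo (0 : ℝ) 1,
      MvPolynomial.eval ![A.1 + t * v, A.2 + t * w] q = 0 := fun t ht => by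
    simpa only [hq] using hvanish _ (hseg t ht)
  have hgrad : ∀ t ∈ Set.Ioo (0 : ℝ) 1,
      MvPolynomial.eval ![A.1 + t * v, A.2 + t * w] (MvPolynomial.pderiv 0 q) = 0 ∧
      MvPolynomial.eval ![A.1 + t * v, A.2 + t * w] (MvPolynomial.pderiv 1 q) = 0 := by
    intro t ht
    have htan := MvPolynomial.tangential_deriv_eq_zero hzero t ht
    have hnor := hnormal _ (hseg t ht)
    simp only [hq, Prod.fst_add, Prod.snd_add, Prod.smul_fst, Prod.smul_snd, smul_eq_mul,
      (MvPolynomial.hasDerivAt_eval_line q _ _ n.1 n.2 0).deriv, zero_mul, add_zero] at hnor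
    set X := MvPolynomial.eval ![A.1 + t * v, A.2 + t * w] (MvPolynomial.pderiv 0 q)
    set Y := MvPolynomial.eval ![A.1 + t * v, A.2 + t * w] (MvPolynomial.pderiv 1 q)
    have hrot := (eq_zero_of_rotation_system (x := v * Y - w * X) (y := 0) hn'
      (by linear_combination Y * horth - w * hnor)
      (by linear_combination X * horth - v * hnor)).1
    exact eq_zero_of_rotation_system hvw htan hrot
  refine MvPolynomial.eq_zero_of_harmonic_of_cauchy_data hvw ?_ hzero (fun i t ht => ?_)
  · refine MvPolynomial.funext fun z => ?_
    have h := hharm (z 0, z 1)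
    simp only [hq, MvPolynomial.iteratedDeriv_two_eval_fst,
      MvPolynomial.iteratedDeriv_two_eval_snd] at h
    have hz : ![z 0, z 1] = z := by
      ext i
      fin_cases i <;> rfl
    rw [map_add, map_zero, ← hz]
    exact h
  · fin_cases i
    exacts [(hgrad t ht).1, (hgrad t ht).2]
end

section
/- Fix a dimension d ≥ 1, an integer m ≥ 0, and a regularity parameter β > 0. Then there exists a constant C > 0, depending only on d, m, and β, such that for every simplex T ⊆ ℝ^d (the convex hull of d+1 affinely independent points) with diameter h_T > 0 that contains a closed ball of radius β·h_T, and for every polynomial function p : ℝ^d → ℝ of total degree at most m that vanishes at at least one point of T, one has ∫_T p² dx ≤ C · h_T² · ∫_T ‖∇p‖² dx. -/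
open MeasureTheory

namespace MvPolynomial

/-- Differentiating does not increase the total degree. -/
theorem totalDegree_pderiv_le {σ R : Type*} [CommSemiring R] (i : σ) (q : MvPolynomial σ R) :
    (pderiv i q).totalDegree ≤ q.totalDegree := by
  classical
  refine Finset.sup_le fun s hs => ?_
  rw [mem_support_iff, coeff_pderiv] at hs
  have h := le_totalDegree (mem_support_iff.2 (left_ne_zero_of_mul hs))
  rw [Finsupp.sum_add_index' (by simp) (by simp)] at h
  exact (Nat.le_add_right _ _).trans h

/-- Substituting polynomials of degree at most one does not increase the total degree. -/
theorem totalDegree_bind₁_le {σ τ R : Type*} [CommSemiring R] (f : σ → MvPolynomial τ R)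
    (hf : ∀ i, (f i).totalDegree ≤ 1) (q : MvPolynomial σ R) :
    (bind₁ f q).totalDegree ≤ q.totalDegree := by
  rw [bind₁, aeval_def, eval₂_eq]
  refine (totalDegree_finsetSum _ _).trans (Finset.sup_le fun s hs => ?_)
  refine (totalDegree_mul _ _).trans ?_
  rw [algebraMap_eq, totalDegree_C, zero_add]
  refine (totalDegree_finsetProd _ _).trans (le_trans ?_ (le_totalDegree hs))
  refine Finset.sum_le_sum fun i _ => (totalDegree_pow _ _).trans ?_
  simpa using Nat.mul_le_mul_left (s i) (hf i)

variable {d : ℕ}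

theorem continuous_eval_euclidean (q : MvPolynomial (Fin d) ℝ) :
    Continuous fun x : EuclideanSpace ℝ (Fin d) => eval (fun i => x i) q :=
  (continuous_eval q).comp (by fun_prop)

/-- The gradient of a polynomial function is the vector of its partial derivatives. -/
theorem hasGradientAt_eval (q : MvPolynomial (Fin d) ℝ) (x : EuclideanSpace ℝ (Fin d)) :
    HasGradientAt (fun y : EuclideanSpace ℝ (Fin d) => eval (fun i => y i) q)
      (WithLp.toLp 2 fun i => eval (fun j => x j) (pderiv i q)) x := by
  rw [hasGradientAt_iff_hasFDerivAt]
  induction q using MvPolynomial.induction_on with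
  | C a =>
    simp only [eval_C, pderiv_C, map_zero]
    refine (hasFDerivAt_const a x).congr_fderiv ?_
    ext v
    simp [PiLp.inner_apply]
  | add p q hp hq =>
    simp only [map_add]
    refine (hp.add hq).congr_fderiv ?_
    ext v
    simp [PiLp.inner_apply, mul_add, Finset.sum_add_distrib]
  | mul_X p i hp =>
    have hX : HasFDerivAt (fun y : EuclideanSpace ℝ (Fin d) => y i)
        (EuclideanSpace.proj i : EuclideanSpace ℝ (Fin d) →L[ℝ] ℝ) x :=
      (EuclideanSpace.proj i : EuclideanSpace ℝ (Fin d) →L[ℝ] ℝ).hasFDerivAt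
    simp only [map_mul, eval_X]
    refine (hp.mul hX).congr_fderiv ?_
    ext v
    simp [PiLp.inner_apply, pderiv_X, Pi.single_apply, mul_add,
      Finset.sum_add_distrib, Finset.mul_sum, apply_ite]
    ring_nf

/-- A polynomial vanishing on a ball of positive radius is zero. -/
theorem eq_zero_of_eval_eq_zero_on_ball {q : MvPolynomial (Fin d) ℝ}
    {r : ℝ} (hr : 0 < r)
    (h : ∀ x ∈ Metric.ball (0 : EuclideanSpace ℝ (Fin d)) r, eval (fun i => x i) q = 0) :
    q = 0 := by
  have hU : IsOpen ((WithLp.toLp 2 : (Fin d → ℝ) → EuclideanSpace ℝ (Fin d)) ⁻¹'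
      Metric.ball 0 r) := Metric.isOpen_ball.preimage (PiLp.continuous_toLp 2 _)
  obtain ⟨ε, hε, hsub⟩ := Metric.isOpen_iff.1 hU 0 (by simpa using hr)
  refine funext_set (fun _ => Metric.ball (0 : ℝ) ε)
    (fun _ => infinite_of_mem_nhds 0 (Metric.ball_mem_nhds 0 hε)) fun x hx => ?_
  rw [map_zero]
  refine h (WithLp.toLp 2 x) (hsub ?_)
  rw [← ball_pi _ hε] at hx
  exact hx

/-- On polynomials of bounded degree, the supremum over the unit ball is controlled by the
`L²` norm on any concentric ball of positive radius. -/
theorem exists_sq_eval_le_integral_closedBall (d m : ℕ) {r : ℝ} (hr : 0 < r) :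
    ∃ K : ℝ, 0 < K ∧ ∀ q : MvPolynomial (Fin d) ℝ, q.totalDegree ≤ m →
      ∀ y ∈ Metric.closedBall (0 : EuclideanSpace ℝ (Fin d)) 1,
        eval (fun i => y i) q ^ 2 ≤
          K * ∫ x in Metric.closedBall (0 : EuclideanSpace ℝ (Fin d)) r,
            eval (fun i => x i) q ^ 2 := by
  let E := EuclideanSpace ℝ (Fin d)
  let μ : Measure E := volume.restrict (Metric.closedBall 0 r)
  let S := Metric.closedBall (0 : E) 1
  have hfin : IsFiniteMeasure μ :=
    ⟨by rw [Measure.restrict_apply_univ]; exact measure_closedBall_lt_top⟩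
  have hmem (q : MvPolynomial (Fin d) ℝ) : MemLp (fun x : E => eval (fun i => x i) q) 2 μ := by
    have hc := continuous_eval_euclidean q
    obtain ⟨M, hM⟩ := (isCompact_closedBall (0 : E) r).exists_bound_of_continuousOn hc.continuousOn
    exact MemLp.of_bound hc.aestronglyMeasurable M
      ((ae_restrict_iff' measurableSet_closedBall).2 (Filter.Eventually.of_forall hM))
  let A : restrictTotalDegree (Fin d) ℝ m →ₗ[ℝ] Lp ℝ 2 μ :=
    { toFun := fun q => (hmem q).toLp _
      map_add' := fun p q => by
        rw [← MemLp.toLp_add]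
        exact MemLp.toLp_congr _ _ (Filter.Eventually.of_forall fun x => by simp)
      map_smul' := fun a q => by
        rw [← MemLp.toLp_const_smul]
        exact MemLp.toLp_congr _ _ (Filter.Eventually.of_forall fun x => by simp) }
  let B : restrictTotalDegree (Fin d) ℝ m →ₗ[ℝ] C(S, ℝ) :=
    { toFun := fun q => ⟨fun x => eval (fun i => x.1 i) q.1,
        (continuous_eval_euclidean q.1).comp continuous_subtype_val⟩
      map_add' := fun p q => by ext; simp
      map_smul' := fun a q => by ext; simp }
  have hA : Function.Injective A := by
    refine (injective_iff_map_eq_zero A).2 fun q hq => Subtype.ext ?_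
    have h0 : (fun x : E => eval (fun i => x i) q.1) =ᵐ[μ] 0 :=
      (hmem q.1).coeFn_toLp.symm.trans ((Lp.eq_zero_iff_ae_eq_zero).1 hq)
    have h1 : (fun x : E => eval (fun i => x i) q.1)
        =ᵐ[volume.restrict (Metric.ball 0 r)] fun _ => 0 :=
      ae_restrict_of_ae_restrict_of_subset Metric.ball_subset_closedBall h0
    exact eq_zero_of_eval_eq_zero_on_ball hr
      (Measure.eqOn_open_of_ae_eq h1 Metric.isOpen_ball
        (continuous_eval_euclidean q.1).continuousOn continuousOn_const)
  let e := LinearEquiv.ofInjective A hA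
  have : FiniteDimensional ℝ (LinearMap.range A) := inferInstance
  let L := LinearMap.toContinuousLinearMap (B ∘ₗ e.symm.toLinearMap)
  refine ⟨‖L‖ ^ 2 + 1, by positivity, fun q hq y hy => ?_⟩
  let q' : restrictTotalDegree (Fin d) ℝ m := ⟨q, (mem_restrictTotalDegree _ _ _).2 hq⟩
  have hL : L (e q') = B q' := by simp [L]
  have hle : ‖B q'‖ ≤ ‖L‖ * ‖A q'‖ := by
    rw [← hL]
    exact L.le_opNorm _
  have hy' : |eval (fun i => y i) q| ≤ ‖B q'‖ := (B q').norm_coe_le_norm ⟨y, hy⟩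
  have hnorm : ‖A q'‖ ^ 2 = ∫ x in Metric.closedBall (0 : E) r, eval (fun i => x i) q ^ 2 := by
    rw [← real_inner_self_eq_norm_sq, L2.inner_def]
    refine integral_congr_ae ?_
    filter_upwards [(hmem q).coeFn_toLp] with x hx
    change inner ℝ ((hmem q).toLp _ x) ((hmem q).toLp _ x) = _
    rw [hx]
    simp [sq]
  rw [← hnorm, ← sq_abs]
  calc |eval (fun i => y i) q| ^ 2 ≤ (‖L‖ * ‖A q'‖) ^ 2 := by
        gcongr
        exact hy'.trans hle
    _ ≤ (‖L‖ ^ 2 + 1) * ‖A q'‖ ^ 2 := by nlinarith [sq_nonneg ‖A q'‖]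

/-- The scaled form of `exists_sq_eval_le_integral_closedBall`, uniform in centre and radius. -/
theorem exists_pow_mul_sq_eval_le_integral_closedBall (d m : ℕ) {β : ℝ} (hβ : 0 < β) :
    ∃ K : ℝ, 0 < K ∧ ∀ q : MvPolynomial (Fin d) ℝ, q.totalDegree ≤ m →
      ∀ (c : EuclideanSpace ℝ (Fin d)) (h : ℝ), 0 < h → ∀ y ∈ Metric.closedBall c h,
        h ^ d * eval (fun i => y i) q ^ 2 ≤
          K * ∫ x in Metric.closedBall c (β * h), eval (fun i => x i) q ^ 2 := by
  obtain ⟨K, hK, H⟩ := exists_sq_eval_le_integral_closedBall d m hβ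
  refine ⟨K, hK, fun q hq c h hh y hy => ?_⟩
  let Q : MvPolynomial (Fin d) ℝ := bind₁ (fun i => C (c i) + C h * X i) q
  have hQ : Q.totalDegree ≤ m := by
    refine (totalDegree_bind₁_le _ (fun i => ?_) q).trans hq
    refine (totalDegree_add _ _).trans (max_le (by simp) ?_)
    exact (totalDegree_mul _ _).trans (by simp)
  have hQe (x : EuclideanSpace ℝ (Fin d)) :
      eval (fun i => x i) Q = eval (fun i => (c + h • x) i) q := by
    change eval _ (bind₁ _ q) = _
    rw [← coe_aeval_eq_eval, RingHom.coe_coe, aeval_bind₁, ← coe_aeval_eq_eval]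
    simp
  have hy1 : h⁻¹ • (y - c) ∈ Metric.closedBall (0 : EuclideanSpace ℝ (Fin d)) 1 := by
    rw [mem_closedBall_zero_iff, norm_smul, norm_inv, Real.norm_of_nonneg hh.le,
      inv_mul_le_one₀ hh]
    simpa [dist_eq_norm] using hy
  have hint : ∫ x in Metric.closedBall (0 : EuclideanSpace ℝ (Fin d)) β,
        eval (fun i => x i) Q ^ 2 =
      (h ^ d)⁻¹ * ∫ x in Metric.closedBall c (β * h), eval (fun i => x i) q ^ 2 := by
    simp only [hQe]
    rw [Measure.setIntegral_comp_smul_of_pos volume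
      (fun x : EuclideanSpace ℝ (Fin d) => eval (fun i => (c + x) i) q ^ 2) _ hh,
      smul_closedBall _ _ hβ.le, smul_zero, Real.norm_of_nonneg hh.le,
      finrank_euclideanSpace_fin, smul_eq_mul, mul_comm h β]
    congr 1
    rw [← (measurePreserving_add_left volume c).setIntegral_preimage_emb
      (measurableEmbedding_addLeft c) _ (Metric.closedBall c (β * h))]
    simp
  have key := H Q hQ _ hy1
  rw [hint, hQe, smul_inv_smul₀ hh.ne', add_sub_cancel] at key
  have hd : 0 < h ^ d := pow_pos hh d
  calc h ^ d * eval (fun i => y i) q ^ 2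
      ≤ h ^ d * (K * ((h ^ d)⁻¹ *
          ∫ x in Metric.closedBall c (β * h), eval (fun i => x i) q ^ 2)) := by gcongr
    _ = _ := by field_simp

/-- A Poincaré-type inequality, uniform over compact sets `T` containing a ball of radius
`β * diam T`, for polynomials of bounded degree that vanish at some point of `T`. -/
theorem exists_integral_sq_eval_le (d m : ℕ) {β : ℝ} (hβ : 0 < β) :
    ∃ C : ℝ, 0 < C ∧ ∀ T : Set (EuclideanSpace ℝ (Fin d)), IsCompact T → 0 < Metric.diam T →
      (∃ c, Metric.closedBall c (β * Metric.diam T) ⊆ T) →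
      ∀ q : MvPolynomial (Fin d) ℝ, q.totalDegree ≤ m →
        (∃ x ∈ T, eval (fun i => x i) q = 0) →
        ∫ x in T, eval (fun i => x i) q ^ 2 ≤ C * Metric.diam T ^ 2 *
          ∫ x in T, ‖gradient (fun y : EuclideanSpace ℝ (Fin d) =>
            eval (fun i => y i) q) x‖ ^ 2 := by
  obtain ⟨K, hK, H⟩ := exists_pow_mul_sq_eval_le_integral_closedBall d m hβ
  let ω : ℝ := volume.real (Metric.closedBall (0 : EuclideanSpace ℝ (Fin d)) 1)
  refine ⟨ω * K + 1, by positivity, ?_⟩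
  intro T hTc hdiam ⟨c, hc⟩ q hq ⟨x₀, hx₀, hqx₀⟩
  set h := Metric.diam T
  have hcT : c ∈ T := hc (Metric.mem_closedBall_self (by positivity))
  have hTB : T ⊆ Metric.closedBall c h := fun x hx =>
    Metric.dist_le_diam_of_mem hTc.isBounded hx hcT
  have hgrad (x : EuclideanSpace ℝ (Fin d)) := (hasGradientAt_eval q x).gradient
  have hnorm (x : EuclideanSpace ℝ (Fin d)) :
      ‖gradient (fun x : EuclideanSpace ℝ (Fin d) => eval (fun i => x i) q) x‖ ^ 2 =
        ∑ i, eval (fun j => x j) (pderiv i q) ^ 2 := by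
    rw [hgrad, EuclideanSpace.real_norm_sq_eq]
  have hcont (i : Fin d) : Continuous fun x : EuclideanSpace ℝ (Fin d) =>
      eval (fun j => x j) (pderiv i q) ^ 2 :=
    (continuous_eval_euclidean _).pow 2
  simp only [hnorm]
  set I := ∫ x in T, ∑ i, eval (fun j => x j) (pderiv i q) ^ 2
  have hI0 : 0 ≤ I := integral_nonneg fun x => Finset.sum_nonneg fun i _ => sq_nonneg _
  have hsup (y : EuclideanSpace ℝ (Fin d)) (hy : y ∈ Metric.closedBall c h) :
      h ^ d * ‖gradient (fun x : EuclideanSpace ℝ (Fin d) =>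
        eval (fun i => x i) q) y‖ ^ 2 ≤ K * I := by
    rw [hnorm, Finset.mul_sum]
    calc _ ≤ ∑ i, K * ∫ x in Metric.closedBall c (β * h),
          eval (fun j => x j) (pderiv i q) ^ 2 :=
        Finset.sum_le_sum fun i _ =>
          H _ ((totalDegree_pderiv_le i q).trans hq) c h hdiam y hy
      _ = K * ∫ x in Metric.closedBall c (β * h),
          ∑ i, eval (fun j => x j) (pderiv i q) ^ 2 := by
        rw [integral_finsetSum _ fun i _ =>
          ((hcont i).continuousOn.integrableOn_compact (isCompact_closedBall _ _)).integrable,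
          Finset.mul_sum]
      _ ≤ K * I := by
        refine mul_le_mul_of_nonneg_left (setIntegral_mono_set ?_ ?_ ?_) hK.le
        · exact (continuous_finsetSum _ fun i _ => hcont i).continuousOn.integrableOn_compact hTc
        · exact Filter.Eventually.of_forall fun x => Finset.sum_nonneg fun i _ => sq_nonneg _
        · exact hc.eventuallyLE
  have hd0 : 0 < h ^ d := pow_pos hdiam d
  set G := Real.sqrt (K * I / h ^ d)
  have hG2 : G ^ 2 = K * I / h ^ d := Real.sq_sqrt (by positivity)
  have hG (y : EuclideanSpace ℝ (Fin d)) (hy : y ∈ Metric.closedBall c h) :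
      ‖fderiv ℝ (fun x : EuclideanSpace ℝ (Fin d) => eval (fun i => x i) q) y‖
        ≤ G := by
    refine Real.le_sqrt_of_sq_le ?_
    rw [le_div_iff₀' hd0]
    simpa [gradient] using hsup y hy
  have hval (x : EuclideanSpace ℝ (Fin d)) (hx : x ∈ T) :
      eval (fun i => x i) q ^ 2 ≤ (G * h) ^ 2 := by
    have hmv := (convex_closedBall c h).norm_image_sub_le_of_norm_fderiv_le (𝕜 := ℝ)
      (fun y _ => (hasGradientAt_eval q y).hasFDerivAt.differentiableAt) hG (hTB hx₀) (hTB hx)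
    rw [hqx₀, sub_zero, ← dist_eq_norm x x₀] at hmv
    refine sq_le_sq' ?_ ?_ <;>
    · have := Metric.dist_le_diam_of_mem hTc.isBounded hx hx₀
      have := hmv.trans (mul_le_mul_of_nonneg_left this (Real.sqrt_nonneg _))
      linarith [abs_le.1 this]
  have hvol : volume.real T ≤ h ^ d * ω := by
    calc volume.real T ≤ volume.real (Metric.closedBall c h) :=
          measureReal_mono hTB measure_closedBall_lt_top.ne
      _ = h ^ d * ω := by
          rw [Measure.addHaar_real_closedBall' _ _ hdiam.le, finrank_euclideanSpace_fin]
  calc ∫ x in T, eval (fun i => x i) q ^ 2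
      ≤ ∫ x in T, (G * h) ^ 2 := by
        refine setIntegral_mono_on ?_ ?_ hTc.measurableSet hval
        · exact ((continuous_eval_euclidean q).pow 2).continuousOn.integrableOn_compact hTc
        · exact continuousOn_const.integrableOn_compact hTc
    _ = volume.real T * (G * h) ^ 2 := by rw [setIntegral_const, smul_eq_mul]
    _ ≤ h ^ d * ω * (G * h) ^ 2 := mul_le_mul_of_nonneg_right hvol (sq_nonneg _)
    _ = ω * K * h ^ 2 * I := by
        rw [mul_pow, hG2]
        field_simp
    _ ≤ (ω * K + 1) * h ^ 2 * I := by
        rw [mul_assoc (ω * K), mul_assoc (ω * K + 1)]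
        exact mul_le_mul_of_nonneg_right (le_add_of_nonneg_right zero_le_one)
          (mul_nonneg (sq_nonneg h) hI0)

end MvPolynomial

/-- scaled Poincaré-type inequality on a simplex for polynomials vanishing at
a point: given `d ≥ 1`, degree bound `m`, and shape-regularity parameter `β > 0`, there is
`C > 0` (depending only on `d`, `m`, `β`) such that for every simplex `T ⊆ ℝ^d` of diameter
`h_T > 0` containing a closed ball of radius `β · h_T`, and every polynomial `p` of total
degree at most `m` vanishing at some point of `T`, one has
`∫_T p² ≤ C h_T² ∫_T ‖∇p‖²`. -/
theorem stmt11 (d : ℕ) (hd : 1 ≤ d) (m : ℕ) (β : ℝ) (hβ : 0 < β) :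
    ∃ C : ℝ, 0 < C ∧
      ∀ (T : Set (EuclideanSpace ℝ (Fin d))),
        (∃ v : Fin (d + 1) → EuclideanSpace ℝ (Fin d),
          AffineIndependent ℝ v ∧ T = convexHull ℝ (Set.range v)) →
        0 < Metric.diam T →
        (∃ c : EuclideanSpace ℝ (Fin d), Metric.closedBall c (β * Metric.diam T) ⊆ T) →
        ∀ p : EuclideanSpace ℝ (Fin d) → ℝ,
          (∃ q : MvPolynomial (Fin d) ℝ, q.totalDegree ≤ m ∧
            ∀ x : EuclideanSpace ℝ (Fin d), p x = MvPolynomial.eval (fun i => x i) q) →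
          (∃ x₀ ∈ T, p x₀ = 0) →
          ∫ x in T, (p x) ^ 2 ≤ C * Metric.diam T ^ 2 * ∫ x in T, ‖gradient p x‖ ^ 2 := by
  obtain ⟨C, hC, H⟩ := MvPolynomial.exists_integral_sq_eval_le d m hβ
  refine ⟨C, hC, ?_⟩
  rintro T ⟨v, -, rfl⟩ hdiam hball p ⟨q, hq, hp⟩ hzero
  obtain rfl : p = fun x => MvPolynomial.eval (fun i => x i) q := funext hp
  exact H _ ((Set.finite_range v).isCompact_convexHull (𝕜 := ℝ)) hdiam hball q hq hzero
end
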